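/- For every integer n ≥ 4, the group G = T3(n) of order 3^n satisfies S(G) = 12 + 2·3^{n−2}, where S(G) = Σ_C log₃ |C_G(g_C)/Frat(C_G(g_C))|, the sum running over the conjugacy classes C of G with g_C ∈ C an arbitrary representative (the summand does not depend on the choice of representative). -/

import Mathlib

/-- The commutator `[x,y] = x⁻¹y⁻¹xy`. -/
def gpComm {G : Type*} [Group G] (x y : G) : G := x⁻¹ * y⁻¹ * x * y

namespace MaxClass3

/-- The free generators `a`, `b`, `c`, `d`. -/
abbrev a : FreeGroup (Fin 4) := FreeGroup.of 0
abbrev b : FreeGroup (Fin 4) := FreeGroup.of 1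
abbrev c : FreeGroup (Fin 4) := FreeGroup.of 2
abbrev d : FreeGroup (Fin 4) := FreeGroup.of 3

/-- The word representing the central element `z`. -/
def zWord (n : ℕ) : FreeGroup (Fin 4) :=
  if Even n then d ^ ((-3 : ℤ) ^ ((n - 4) / 2)) else c ^ ((-3 : ℤ) ^ ((n - 3) / 2))

/-- Relators of the group `𝒦(n)`: `c = [b,a]`, `d = [c,a]`, `[d,a] = c⁻³d⁻³`,
`[d,b] = [d,c] = 1`, together with the exponent relations depending on the parity of `n`. -/
def Krels (n : ℕ) : Set (FreeGroup (Fin 4)) :=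
  {c⁻¹ * gpComm b a, d⁻¹ * gpComm c a, gpComm d a * d ^ 3 * c ^ 3, gpComm d b, gpComm d c} ∪
    (if Even n then {c ^ 3 ^ ((n - 2) / 2), d ^ 3 ^ ((n - 2) / 2)}
     else {c ^ 3 ^ ((n - 1) / 2), d ^ 3 ^ ((n - 3) / 2)})

/-- Relators of `T3(n)`: those of `𝒦(n)` together with `a³ = 1`, `b³ = c⁻³d⁻¹z⁻¹`, `[c,b] = 1`. -/
def T3rels (n : ℕ) : Set (FreeGroup (Fin 4)) :=
  Krels n ∪ {a ^ 3, b ^ 3 * zWord n * d * c ^ 3, gpComm c b}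

/-- The group `T3(n)`. -/
abbrev T3 (n : ℕ) : Type := PresentedGroup (T3rels n)

end MaxClass3

/-- `S(G) = Σ_C log₃ |C_G(g_C)/Frat(C_G(g_C))|`, the sum over the conjugacy classes `C` of `G`
of the `3`-logarithm of the order of the Frattini quotient of the centralizer of a
representative of `C`. -/
noncomputable def SInvariant (G : Type*) [Group G] : ℕ :=
  ∑ᶠ C : ConjClasses G,
    Nat.log 3 (Nat.card
      (↥(Subgroup.centralizer {(ConjClasses.exists_rep C).choose}) ⧸
        frattini ↥(Subgroup.centralizer {(ConjClasses.exists_rep C).choose})))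


section FrattiniQuotient

variable {P : Type*} [Group P] [Finite P] {p : ℕ} [Fact p.Prime]

theorem IsPGroup.index_eq_of_isCoatom (hP : IsPGroup p P) {M : Subgroup P} (hM : IsCoatom M) :
    M.index = p := by
  obtain ⟨k, hk⟩ := IsPGroup.iff_card.1 (hP.to_subgroup M)
  obtain ⟨j, hj⟩ := hP.index M
  have hmul := M.card_mul_index
  have hj0 : j ≠ 0 := by
    rintro rfl
    exact hM.1 (Subgroup.index_eq_one.1 (by simpa using hj))
  obtain ⟨j, rfl⟩ := Nat.exists_eq_succ_of_ne_zero hj0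
  have hp := (Fact.out : p.Prime).pos
  obtain ⟨K, hK, hMK⟩ := Sylow.exists_subgroup_card_pow_succ (p := p) (n := k) (G := P)
    (by rw [← hmul, hk, hj, ← pow_add]; exact pow_dvd_pow _ (by omega)) hk
  rcases hM.le_iff.1 hMK with rfl | rfl
  · rw [Subgroup.card_top, ← hmul, hk, pow_succ] at hK
    exact Nat.eq_of_mul_eq_mul_left (pow_pos hp k) hK
  · have := Nat.pow_right_injective (Fact.out : p.Prime).two_le (hk.symm.trans hK)
    omega

theorem IsPGroup.normal_of_isCoatom (hP : IsPGroup p P) {M : Subgroup P} (hM : IsCoatom M) :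
    M.Normal := by
  have h := (Group.isNilpotent_of_finite_tfae (G := P)).out 0 2
  exact h.1 hP.isNilpotent M hM

theorem IsPGroup.pow_mem_frattini (hP : IsPGroup p P) (x : P) : x ^ p ∈ frattini P := by
  simp only [frattini, Order.radical, Subgroup.mem_iInf]
  intro M hM
  have := hP.normal_of_isCoatom hM
  have h := M.pow_index_mem x
  rwa [hP.index_eq_of_isCoatom hM] at h

theorem IsPGroup.mul_comm_quotient_frattini (hP : IsPGroup p P) (x y : P ⧸ frattini P) :
    x * y = y * x := by
  induction x using QuotientGroup.induction_on with | H x => ?_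
  induction y using QuotientGroup.induction_on with | H y => ?_
  rw [← QuotientGroup.mk_mul, ← QuotientGroup.mk_mul, QuotientGroup.eq]
  simp only [frattini, Order.radical, Subgroup.mem_iInf]
  intro M hM
  have := hP.normal_of_isCoatom hM
  have : IsCyclic (P ⧸ M) := isCyclic_of_prime_card (p := p) (hP.index_eq_of_isCoatom hM)
  let := IsCyclic.commGroup (α := P ⧸ M)
  rw [← QuotientGroup.eq, QuotientGroup.mk_mul, QuotientGroup.mk_mul]
  exact mul_comm (x : P ⧸ M) y

theorem isCyclic_of_isCyclic_quotient_frattini (h : IsCyclic (P ⧸ frattini P)) : IsCyclic P := by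
  obtain ⟨g, hg⟩ := h.exists_generator
  induction g using QuotientGroup.induction_on with | H g => ?_
  have : Subgroup.zpowers g = ⊤ := by
    apply frattini_nongenerating
    rw [eq_top_iff]
    intro x _
    obtain ⟨k, hk⟩ := hg x
    simp only at hk
    rw [← QuotientGroup.mk_zpow, QuotientGroup.eq] at hk
    rw [← mul_inv_cancel_left (g ^ k) x]
    exact Subgroup.mul_mem_sup (Subgroup.zpow_mem _ (Subgroup.mem_zpowers g) k) hk
  exact ⟨g, fun x => (Subgroup.eq_top_iff' _).1 this x⟩

theorem IsPGroup.card_quotient_frattini_le (hP : IsPGroup p P) {u v : P}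
    (huv : Subgroup.closure {u, v} = ⊤) : Nat.card (P ⧸ frattini P) ≤ p ^ 2 := by
  let := (inferInstance : Group (P ⧸ frattini P))
  let Q : CommGroup (P ⧸ frattini P) :=
    { this with mul_comm := hP.mul_comm_quotient_frattini }
  have hpow (x : P ⧸ frattini P) : x ^ p = 1 := by
    induction x using QuotientGroup.induction_on with | H x => ?_
    rw [← QuotientGroup.mk_pow, QuotientGroup.eq_one_iff]
    exact hP.pow_mem_frattini x
  have hz (x : P ⧸ frattini P) (k : ℤ) : x ^ k = x ^ (k % p) := by
    rw [zpow_eq_zpow_emod' k (hpow x)]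
  have hp := (Fact.out : p.Prime).pos
  let f : Fin p × Fin p → P ⧸ frattini P :=
    fun ij => (u : P ⧸ frattini P) ^ (ij.1 : ℕ) * (v : P ⧸ frattini P) ^ (ij.2 : ℕ)
  have hf : Function.Surjective f := by
    intro x
    have hx : x ∈ Subgroup.closure {(u : P ⧸ frattini P), (v : P ⧸ frattini P)} := by
      have : Subgroup.closure {(u : P ⧸ frattini P), (v : P ⧸ frattini P)} = ⊤ := by
        have h := MonoidHom.map_closure (QuotientGroup.mk' (frattini P)) {u, v}
        rw [huv, Subgroup.map_top_of_surjective _ (QuotientGroup.mk'_surjective _),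
          Set.image_pair] at h
        exact h.symm
      rw [this]; trivial
    obtain ⟨i, j, rfl⟩ := Subgroup.mem_closure_pair.1 hx
    have aux (k : ℤ) : ∃ m : Fin p, ((m : ℕ) : ℤ) = k % p := by
      have h1 := Int.emod_nonneg k (by omega : (p : ℤ) ≠ 0)
      have h2 := Int.emod_lt_of_pos k (by omega : (0 : ℤ) < p)
      exact ⟨⟨(k % p).toNat, by omega⟩, by simp [h1]⟩
    obtain ⟨i', hi⟩ := aux i
    obtain ⟨j', hj⟩ := aux j
    refine ⟨(i', j'), ?_⟩
    rw [hz _ i, hz _ j, ← hi, ← hj, zpow_natCast, zpow_natCast]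
  have := Nat.card_le_card_of_surjective f hf
  simpa [sq] using this

theorem IsPGroup.sq_le_card_quotient_frattini (hP : IsPGroup p P) (hc : ¬ IsCyclic P) :
    p ^ 2 ≤ Nat.card (P ⧸ frattini P) := by
  obtain ⟨k, hk⟩ := IsPGroup.iff_card.1 (hP.to_quotient (frattini P))
  rw [hk]
  apply Nat.pow_le_pow_right (Fact.out : p.Prime).pos
  by_contra! h
  apply hc
  apply isCyclic_of_isCyclic_quotient_frattini
  interval_cases k
  · have := (Nat.card_eq_one_iff_unique.1 (by simpa using hk)).1
    infer_instance
  · exact isCyclic_of_prime_card (p := p) (by simpa using hk)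

theorem IsPGroup.log_card_quotient_frattini_eq_two (hP : IsPGroup p P) (hc : ¬ IsCyclic P)
    {u v : P} (huv : Subgroup.closure {u, v} = ⊤) :
    Nat.log p (Nat.card (P ⧸ frattini P)) = 2 := by
  rw [le_antisymm (hP.card_quotient_frattini_le huv) (hP.sq_le_card_quotient_frattini hc)]
  exact Nat.log_pow (Fact.out : p.Prime).one_lt 2

theorem IsPGroup.log_card_quotient_frattini_eq_one (hP : IsPGroup p P) [Nontrivial P]
    {u : P} (hu : Subgroup.zpowers u = ⊤) :
    Nat.log p (Nat.card (P ⧸ frattini P)) = 1 := by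
  have hgen (x : P ⧸ frattini P) : x ∈ Subgroup.zpowers (u : P ⧸ frattini P) := by
    induction x using QuotientGroup.induction_on with | H x => ?_
    obtain ⟨k, rfl⟩ := Subgroup.mem_zpowers_iff.1 (hu ▸ Subgroup.mem_top x)
    rw [QuotientGroup.mk_zpow]
    exact Subgroup.zpow_mem_zpowers _ k
  have hp : Nat.card (P ⧸ frattini P) ∣ p := by
    rw [← orderOf_eq_card_of_forall_mem_zpowers hgen]
    apply orderOf_dvd_of_pow_eq_one
    rw [← QuotientGroup.mk_pow, QuotientGroup.eq_one_iff]
    exact hP.pow_mem_frattini u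
  rcases (Nat.dvd_prime (Fact.out : p.Prime)).1 hp with h | h
  · exfalso
    have h1 : frattini P = ⊤ := Subgroup.index_eq_one.1 h
    exact bot_ne_top (frattini_nongenerating (K := ⊥) (by rw [h1, sup_top_eq]))
  · rw [h]
    simpa using Nat.log_pow (Fact.out : p.Prime).one_lt 1

end FrattiniQuotient

theorem sum_conjClasses_mul_card {G : Type*} [Group G] [Finite G] [Fintype G] (f : G → ℕ)
    (hf : ∀ x y, IsConj x y → f x = f y) (F : ConjClasses G → ℕ) (hF : ∀ x, F (.mk x) = f x) :
    ∑ g, f g * Nat.card (Subgroup.centralizer {g}) = Nat.card G * ∑ᶠ C, F C := by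
  classical
  have := Fintype.ofFinite (ConjClasses G)
  rw [finsum_eq_sum_of_fintype, Finset.mul_sum,
    ← Finset.sum_fiberwise_of_maps_to (t := Finset.univ) (g := ConjClasses.mk)
      (fun _ _ => Finset.mem_univ _)]
  refine Finset.sum_congr rfl fun C _ => ?_
  induction C using Quotient.inductionOn with | h x => ?_
  change ∑ i with ConjClasses.mk i = ConjClasses.mk x, _ = _ * F (ConjClasses.mk x)
  have horb (y : G) : Nat.card (ConjClasses.mk y).carrier *
      Nat.card (Subgroup.centralizer {y}) = Nat.card G := by
    rw [Subgroup.nat_card_centralizer_nat_card_stabilizer, ← ConjAct.orbit_eq_carrier_conjClasses,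
      Nat.card_coe_set_eq, ← MulAction.index_stabilizer, mul_comm, Subgroup.card_mul_index]
    rfl
  have hpos : 0 < Nat.card (ConjClasses.mk x).carrier := by
    apply Nat.pos_of_ne_zero
    intro h
    have := horb x
    rw [h, zero_mul] at this
    exact Nat.card_pos.ne this
  have hterm : ∀ y ∈ Finset.univ.filter (fun i => ConjClasses.mk i = ConjClasses.mk x),
      f y * Nat.card (Subgroup.centralizer {y}) = f x * Nat.card (Subgroup.centralizer {x}) := by
    intro y hy
    have hy : ConjClasses.mk y = ConjClasses.mk x := (Finset.mem_filter.1 hy).2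
    rw [hf y x (ConjClasses.mk_eq_mk_iff_isConj.1 hy)]
    congr 1
    apply Nat.eq_of_mul_eq_mul_left hpos
    rw [horb, ← hy, horb]
  rw [Finset.sum_congr rfl hterm, Finset.sum_const, smul_eq_mul, hF, ← horb x]
  have : (Finset.univ.filter (fun i => ConjClasses.mk i = ConjClasses.mk x)).card =
      Nat.card (ConjClasses.mk x).carrier := by
    rw [Nat.card_eq_fintype_card, Fintype.card_subtype]
    congr 1
    ext y
    simp [ConjClasses.mem_carrier_iff_mk_eq]
  rw [this]
  ring


/-- Generators and homomorphisms exhibiting `G` as a `3`-group of maximal class whose maximal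
subgroup `⟨b, c, d⟩` is abelian, with `⟨c, d⟩` of type `(q, r)`. -/
structure MaxClassData {G : Type*} [Group G] (a b c d z : G)
    (φ ψ : G →* Multiplicative (ZMod 3)) (q r : ℕ) : Prop where
  closure_eq : Subgroup.closure {a, b, c, d} = ⊤
  conj_b : a⁻¹ * b * a = b * c
  conj_c : a⁻¹ * c * a = c * d
  conj_d : a⁻¹ * d * a = d * (d ^ 3 * c ^ 3)⁻¹
  comm_bc : b * c = c * b
  comm_bd : b * d = d * b
  comm_cd : c * d = d * c
  a_pow : a ^ 3 = 1
  b_pow : b ^ 3 * z * d * c ^ 3 = 1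
  z_mem : z ∈ Subgroup.closure {c, d}
  z_pow : z ^ 3 = 1
  z_ne : z ≠ 1
  d_mem : d ∈ Subgroup.closure {b, c}
  c_pow : c ^ q = 1
  d_pow : d ^ r = 1
  indep : ∀ i j : ℤ, c ^ i * d ^ j = 1 → (q : ℤ) ∣ i ∧ (r : ℤ) ∣ j
  φ_a : φ a = .ofAdd 1
  φ_b : φ b = 1
  φ_c : φ c = 1
  φ_d : φ d = 1
  ψ_a : ψ a = 1
  ψ_b : ψ b = .ofAdd 1
  ψ_c : ψ c = 1
  ψ_d : ψ d = 1
  dvd : r ∣ q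
  one_lt : 1 < r
  three_dvd : 3 ∣ q
  exists_pow : ∃ k : ℕ, q * r = 3 ^ k

namespace MaxClassData

variable {G : Type*} [Group G] {a b c d z : G} {φ ψ : G →* Multiplicative (ZMod 3)} {q r : ℕ}

theorem ofAdd_one_zpow_eq_one_iff (i : ℤ) :
    (Multiplicative.ofAdd (1 : ZMod 3)) ^ i = 1 ↔ (3 : ℤ) ∣ i := by
  have h : orderOf (Multiplicative.ofAdd (1 : ZMod 3)) = 3 :=
    orderOf_eq_prime (by decide) (by decide)
  rw [← orderOf_dvd_iff_zpow_eq_one, h]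
  rfl

theorem eq_one_or_eq_or_eq (t : Multiplicative (ZMod 3)) :
    t = 1 ∨ t = .ofAdd 1 ∨ t = .ofAdd 1 ^ 2 := by
  revert t
  decide

theorem q_pos (h : MaxClassData a b c d z φ ψ q r) : 0 < q * r := by
  obtain ⟨k, hk⟩ := h.exists_pow
  rw [hk]
  positivity

theorem exists_of_mem_closure_pair (h : MaxClassData a b c d z φ ψ q r) {x : G}
    (hx : x ∈ Subgroup.closure {c, d}) : ∃ i j : ℤ, x = c ^ i * d ^ j := by
  have hcd : Commute c d := h.comm_cd
  induction hx using Subgroup.closure_induction with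
  | mem x hx =>
    rcases hx with rfl | rfl
    · exact ⟨1, 0, by simp⟩
    · exact ⟨0, 1, by simp⟩
  | one => exact ⟨0, 0, by simp⟩
  | mul x y _ _ hx hy =>
    obtain ⟨i, j, rfl⟩ := hx
    obtain ⟨i', j', rfl⟩ := hy
    refine ⟨i + i', j + j', ?_⟩
    rw [zpow_add, zpow_add, mul_assoc, ← mul_assoc (d ^ j),
      ((hcd.zpow_zpow i' j).eq.symm : d ^ j * c ^ i' = _)]
    group
  | inv x _ hx =>
    obtain ⟨i, j, rfl⟩ := hx
    refine ⟨-i, -j, ?_⟩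
    rw [mul_inv_rev, ← zpow_neg, ← zpow_neg]
    exact (hcd.zpow_zpow _ _).eq.symm

theorem commute_of_mem_closure (h : MaxClassData a b c d z φ ψ q r) {x y : G}
    (hx : x ∈ Subgroup.closure {b, c, d}) (hy : y ∈ Subgroup.closure {b, c, d}) :
    Commute x y := by
  have := Subgroup.isMulCommutative_closure (k := {b, c, d}) (by
    have h1 := h.comm_bc
    have h2 := h.comm_bd
    have h3 := h.comm_cd
    rintro x (rfl | rfl | rfl) y (rfl | rfl | rfl) <;> simp_all)
  exact setLike_mul_comm hx hy

theorem pair_le (b c d : G) :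
    Subgroup.closure {c, d} ≤ Subgroup.closure {b, c, d} :=
  Subgroup.closure_mono (Set.subset_insert _ _)

theorem b_mem (b c d : G) : b ∈ Subgroup.closure {b, c, d} := Subgroup.subset_closure (by simp)
theorem c_mem (b c d : G) : c ∈ Subgroup.closure {b, c, d} := Subgroup.subset_closure (by simp)
theorem d_mem' (b c d : G) : d ∈ Subgroup.closure {b, c, d} := Subgroup.subset_closure (by simp)

theorem exists_zpow_mul (h : MaxClassData a b c d z φ ψ q r) {x : G}
    (hx : x ∈ Subgroup.closure {b, c, d}) :
    ∃ i : ℤ, ∃ m ∈ Subgroup.closure {c, d}, x = b ^ i * m := by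
  induction hx using Subgroup.closure_induction with
  | mem x hx =>
    rcases hx with rfl | rfl | rfl
    · exact ⟨1, 1, one_mem _, by simp⟩
    · exact ⟨0, x, Subgroup.subset_closure (by simp), by simp⟩
    · exact ⟨0, x, Subgroup.subset_closure (by simp), by simp⟩
  | one => exact ⟨0, 1, one_mem _, by simp⟩
  | mul x y _ _ hx hy =>
    obtain ⟨i, m, hm, rfl⟩ := hx
    obtain ⟨j, m', hm', rfl⟩ := hy
    refine ⟨i + j, m * m', mul_mem hm hm', ?_⟩
    have := (h.commute_of_mem_closure (pair_le b c d hm) (zpow_mem (b_mem b c d) j)).eq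
    rw [zpow_add, mul_assoc, ← mul_assoc m, this]
    group
  | inv x _ hx =>
    obtain ⟨i, m, hm, rfl⟩ := hx
    refine ⟨-i, m⁻¹, inv_mem hm, ?_⟩
    rw [mul_inv_rev, ← zpow_neg]
    exact (h.commute_of_mem_closure (pair_le b c d (inv_mem hm)) (zpow_mem (b_mem b c d) _)).eq

theorem conj_mem (h : MaxClassData a b c d z φ ψ q r) {x : G}
    (hx : x ∈ Subgroup.closure {b, c, d}) : a⁻¹ * x * a ∈ Subgroup.closure {b, c, d} := by
  have hle : Subgroup.closure {b, c, d} ≤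
      (Subgroup.closure {b, c, d}).comap (MulAut.conj a⁻¹).toMonoidHom := by
    rw [Subgroup.closure_le]
    have hb := b_mem b c d
    have hc := c_mem b c d
    have hd := d_mem' b c d
    rintro x (rfl | rfl | rfl) <;>
      simp only [Subgroup.coe_comap, Set.mem_preimage, MulEquiv.toMonoidHom_eq_coe,
        MonoidHom.coe_coe, MulAut.conj_apply, inv_inv, SetLike.mem_coe]
    · rw [h.conj_b]
      exact mul_mem hb hc
    · rw [h.conj_c]
      exact mul_mem hc hd
    · rw [h.conj_d]
      exact mul_mem hd (inv_mem (mul_mem (pow_mem hd 3) (pow_mem hc 3)))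
  simpa using hle hx

theorem normal (h : MaxClassData a b c d z φ ψ q r) : (Subgroup.closure {b, c, d}).Normal := by
  rw [← Subgroup.normalizer_eq_top_iff, eq_top_iff, ← h.closure_eq, Subgroup.closure_le]
  have hself : ∀ x ∈ Subgroup.closure {b, c, d},
      x ∈ Subgroup.normalizer (Subgroup.closure {b, c, d} : Set G) :=
    fun x hx => Subgroup.le_normalizer hx
  rintro x (rfl | rfl | rfl | rfl)
  · rw [SetLike.mem_coe, Subgroup.mem_normalizer_iff]
    intro y
    have ha : x⁻¹ * x⁻¹ = x := by
      have := h.a_pow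
      rw [pow_succ, sq] at this
      rw [← mul_inv_rev, inv_eq_iff_eq_inv, eq_inv_iff_mul_eq_one]
      exact this
    constructor
    · intro hy
      have h1 := h.conj_mem (h.conj_mem hy)
      have h2 : x⁻¹ * (x⁻¹ * y * x) * x = (x⁻¹ * x⁻¹) * y * (x⁻¹ * x⁻¹)⁻¹ := by
        simp only [mul_inv_rev, inv_inv, mul_assoc]
      rwa [h2, ha] at h1
    · intro hy
      have h1 := h.conj_mem hy
      convert h1 using 1
      group
  · exact hself _ (b_mem _ _ _)
  · exact hself _ (c_mem _ _ _)
  · exact hself _ (d_mem' _ _ _)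

theorem closure_le_ker (h : MaxClassData a b c d z φ ψ q r) :
    Subgroup.closure {b, c, d} ≤ φ.ker := by
  rw [Subgroup.closure_le]
  rintro x (rfl | rfl | rfl)
  exacts [h.φ_b, h.φ_c, h.φ_d]

theorem exists_zpow_a_mul (h : MaxClassData a b c d z φ ψ q r) (x : G) :
    ∃ i : ℤ, ∃ y ∈ Subgroup.closure {b, c, d}, x = a ^ i * y := by
  have := h.normal
  have htop : Subgroup.zpowers a ⊔ Subgroup.closure {b, c, d} = ⊤ := by
    rw [Subgroup.zpowers_eq_closure, ← Subgroup.closure_union, ← h.closure_eq]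
    rfl
  obtain ⟨u, hu, y, hy, rfl⟩ := Subgroup.mem_sup_of_normal_right.1 (htop ▸ Subgroup.mem_top x)
  obtain ⟨i, rfl⟩ := Subgroup.mem_zpowers_iff.1 hu
  exact ⟨i, y, hy, rfl⟩

theorem ker_φ (h : MaxClassData a b c d z φ ψ q r) : φ.ker = Subgroup.closure {b, c, d} := by
  refine le_antisymm (fun x hx => ?_) h.closure_le_ker
  obtain ⟨i, y, hy, rfl⟩ := h.exists_zpow_a_mul x
  have hy' := h.closure_le_ker hy
  rw [MonoidHom.mem_ker] at hx hy'
  rw [map_mul, map_zpow, hy', mul_one, h.φ_a, ofAdd_one_zpow_eq_one_iff] at hx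
  obtain ⟨j, rfl⟩ := hx
  have ha : a ^ (3 * j) = 1 := by
    rw [zpow_mul]
    norm_cast
    rw [h.a_pow, one_zpow]
  rwa [ha, one_mul]

theorem commute_of_mem_ker (h : MaxClassData a b c d z φ ψ q r) {x y : G}
    (hx : φ x = 1) (hy : φ y = 1) : Commute x y :=
  h.commute_of_mem_closure (h.ker_φ ▸ hx) (h.ker_φ ▸ hy)

theorem closure_pair_le_ker (h : MaxClassData a b c d z φ ψ q r) :
    Subgroup.closure {c, d} ≤ ψ.ker := by
  rw [Subgroup.closure_le]
  rintro x (rfl | rfl)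
  exacts [h.ψ_c, h.ψ_d]

theorem ker_inf_ker (h : MaxClassData a b c d z φ ψ q r) :
    φ.ker ⊓ ψ.ker = Subgroup.closure {c, d} := by
  apply le_antisymm
  · rintro x ⟨hx, hx'⟩
    rw [h.ker_φ] at hx
    obtain ⟨i, m, hm, rfl⟩ := h.exists_zpow_mul hx
    have hm' : ψ m = 1 := h.closure_pair_le_ker hm
    have hx' : ψ (b ^ i * m) = 1 := hx'
    rw [map_mul, map_zpow, hm', mul_one, h.ψ_b, ofAdd_one_zpow_eq_one_iff] at hx'
    obtain ⟨j, rfl⟩ := hx'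
    refine mul_mem ?_ hm
    rw [zpow_mul]
    apply zpow_mem
    have hc : c ∈ Subgroup.closure {c, d} := Subgroup.subset_closure (by simp)
    have hd : d ∈ Subgroup.closure {c, d} := Subgroup.subset_closure (by simp)
    have hb : b ^ (3 : ℤ) = (z * d * c ^ 3)⁻¹ := by
      rw [eq_inv_iff_mul_eq_one]
      norm_cast
      simpa only [mul_assoc] using h.b_pow
    rw [hb]
    exact inv_mem (mul_mem (mul_mem h.z_mem hd) (pow_mem hc 3))
  · exact le_inf ((pair_le b c d).trans h.closure_le_ker) h.closure_pair_le_ker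

theorem card_closure_pair (h : MaxClassData a b c d z φ ψ q r) :
    Nat.card (Subgroup.closure {c, d}) = q * r := by
  have hc : c ∈ Subgroup.closure {c, d} := Subgroup.subset_closure (by simp)
  have hd : d ∈ Subgroup.closure {c, d} := Subgroup.subset_closure (by simp)
  have hqr := h.q_pos
  have hcd : Commute c d := h.comm_cd
  let f : Fin q × Fin r → Subgroup.closure {c, d} :=
    fun ij => ⟨c ^ (ij.1 : ℕ) * d ^ (ij.2 : ℕ), mul_mem (pow_mem hc _) (pow_mem hd _)⟩
  have hf : Function.Bijective f := by
    constructor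
    · rintro ⟨i, j⟩ ⟨i', j'⟩ hij
      have hij : c ^ (i : ℕ) * d ^ (j : ℕ) = c ^ (i' : ℕ) * d ^ (j' : ℕ) :=
        congrArg Subtype.val hij
      have := h.indep ((i : ℤ) - i') ((j : ℤ) - j') (by
        rw [zpow_sub, sub_eq_neg_add (j : ℤ), zpow_add]
        simp only [zpow_natCast, zpow_neg]
        have : (c ^ (i' : ℕ))⁻¹ * (d ^ (j' : ℕ))⁻¹ = (c ^ (i' : ℕ) * d ^ (j' : ℕ))⁻¹ := by
          rw [(hcd.pow_pow _ _).eq, mul_inv_rev]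
        have h2 := (hcd.pow_pow i i').eq
        calc c ^ (i : ℕ) * (c ^ (i' : ℕ))⁻¹ * ((d ^ (j' : ℕ))⁻¹ * d ^ (j : ℕ))
            = c ^ (i : ℕ) * ((c ^ (i' : ℕ))⁻¹ * (d ^ (j' : ℕ))⁻¹) * d ^ (j : ℕ) := by group
          _ = c ^ (i : ℕ) * (c ^ (i : ℕ) * d ^ (j : ℕ))⁻¹ * d ^ (j : ℕ) := by rw [this, hij]
          _ = c ^ (i : ℕ) * (d ^ (j : ℕ) * c ^ (i : ℕ))⁻¹ * d ^ (j : ℕ) := by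
            rw [(hcd.pow_pow _ _).eq]
          _ = 1 := by group)
      obtain ⟨h1, h2⟩ := this
      have e1 := Int.eq_zero_of_abs_lt_dvd h1 (by rw [abs_lt]; omega)
      have e2 := Int.eq_zero_of_abs_lt_dvd h2 (by rw [abs_lt]; omega)
      ext <;> dsimp <;> omega
    · rintro ⟨x, hx⟩
      obtain ⟨i, j, rfl⟩ := h.exists_of_mem_closure_pair hx
      have aux (k : ℤ) (s : ℕ) (hs : 0 < s) : ∃ m : Fin s, ((m : ℕ) : ℤ) = k % s := by
        have h1 := Int.emod_nonneg k (by omega : (s : ℤ) ≠ 0)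
        have h2 := Int.emod_lt_of_pos k (by omega : (0 : ℤ) < s)
        exact ⟨⟨(k % s).toNat, by omega⟩, by simp [h1]⟩
      obtain ⟨i', hi⟩ := aux i q (Nat.pos_of_mul_pos_right hqr)
      obtain ⟨j', hj⟩ := aux j r (Nat.pos_of_mul_pos_left hqr)
      refine ⟨(i', j'), Subtype.ext ?_⟩
      change c ^ (i' : ℕ) * d ^ (j' : ℕ) = c ^ i * d ^ j
      rw [zpow_eq_zpow_emod' i h.c_pow, zpow_eq_zpow_emod' j h.d_pow, ← hi, ← hj,
        zpow_natCast, zpow_natCast]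
  rw [← Nat.card_congr (Equiv.ofBijective f hf)]
  simp

theorem card_range_eq_three {H : Type*} [Group H] (f : H →* Multiplicative (ZMod 3)) {x : H}
    (hx : f x ≠ 1) : Nat.card f.range = 3 := by
  have h3 : Nat.card (Multiplicative (ZMod 3)) = 3 := by simp
  have hdvd : Nat.card f.range ∣ 3 := (Subgroup.card_subgroup_dvd_card f.range).trans h3.dvd
  rcases (Nat.dvd_prime Nat.prime_three).1 hdvd with h | h
  · rw [Subgroup.card_eq_one] at h
    have : f x ∈ f.range := ⟨x, rfl⟩
    rw [h] at this
    exact absurd this hx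
  · exact h

theorem card_eq_card_ker_mul_three {H : Type*} [Group H] (f : H →* Multiplicative (ZMod 3))
    {x : H} (hx : f x ≠ 1) : Nat.card H = Nat.card f.ker * 3 := by
  rw [← f.ker.card_mul_index, Subgroup.index_ker, card_range_eq_three f hx]

theorem card_ker_φ (h : MaxClassData a b c d z φ ψ q r) : Nat.card φ.ker = 3 * (q * r) := by
  have h1 := card_eq_card_ker_mul_three (ψ.comp φ.ker.subtype) (x := ⟨b, h.φ_b⟩)
    (by change ψ b ≠ 1; rw [h.ψ_b]; decide)
  have h2 : (ψ.comp φ.ker.subtype).ker = (Subgroup.closure {c, d}).subgroupOf φ.ker := by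
    rw [← h.ker_inf_ker]
    ext x
    simp [Subgroup.mem_subgroupOf, MonoidHom.mem_ker]
  rw [h1, h2, Nat.card_congr (Subgroup.subgroupOfEquivOfLe
    (h.ker_inf_ker ▸ inf_le_left)).toEquiv, h.card_closure_pair, mul_comm]

theorem card_eq (h : MaxClassData a b c d z φ ψ q r) : Nat.card G = 9 * (q * r) := by
  rw [card_eq_card_ker_mul_three φ (x := a) (by rw [h.φ_a]; decide), h.card_ker_φ]
  ring

theorem card_ker_ψ (h : MaxClassData a b c d z φ ψ q r) : Nat.card ψ.ker = 3 * (q * r) := by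
  have h1 := card_eq_card_ker_mul_three ψ (x := b) (by rw [h.ψ_b]; decide)
  rw [h.card_eq] at h1
  omega

theorem finite (h : MaxClassData a b c d z φ ψ q r) : Finite G := by
  apply Nat.finite_of_card_ne_zero
  have := h.q_pos
  rw [h.card_eq]
  omega

theorem isPGroup (h : MaxClassData a b c d z φ ψ q r) : IsPGroup 3 G := by
  obtain ⟨k, hk⟩ := h.exists_pow
  apply IsPGroup.of_card (n := k + 2)
  rw [h.card_eq, hk, pow_add]
  ring

/-- The commutator map `x ↦ [x, a]` on the abelian maximal subgroup. -/
def commHom (h : MaxClassData a b c d z φ ψ q r) : φ.ker →* G where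
  toFun x := (x : G)⁻¹ * (a⁻¹ * x * a)
  map_one' := by simp
  map_mul' := by
    rintro ⟨x, hx⟩ ⟨y, hy⟩
    have hx : φ x = 1 := hx
    have hy : φ y = 1 := hy
    have e := (h.commute_of_mem_ker (x := x⁻¹ * (a⁻¹ * x * a)) (y := y⁻¹)
      (by simp [hx]) (by simp [hy])).eq
    calc (x * y)⁻¹ * (a⁻¹ * (x * y) * a)
        = y⁻¹ * (x⁻¹ * (a⁻¹ * x * a)) * (a⁻¹ * y * a) := by group
      _ = (x⁻¹ * (a⁻¹ * x * a)) * (y⁻¹ * (a⁻¹ * y * a)) := by rw [← e]; group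

theorem range_commHom (h : MaxClassData a b c d z φ ψ q r) :
    h.commHom.range = Subgroup.closure {c, d} := by
  have hc : c ∈ Subgroup.closure {c, d} := Subgroup.subset_closure (by simp)
  have hd : d ∈ Subgroup.closure {c, d} := Subgroup.subset_closure (by simp)
  have eb : h.commHom ⟨b, h.φ_b⟩ = c := by
    change b⁻¹ * (a⁻¹ * b * a) = c
    rw [h.conj_b, inv_mul_cancel_left]
  have ec : h.commHom ⟨c, h.φ_c⟩ = d := by
    change c⁻¹ * (a⁻¹ * c * a) = d
    rw [h.conj_c, inv_mul_cancel_left]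
  have ed : h.commHom ⟨d, h.φ_d⟩ = (d ^ 3 * c ^ 3)⁻¹ := by
    change d⁻¹ * (a⁻¹ * d * a) = _
    rw [h.conj_d, inv_mul_cancel_left]
  apply le_antisymm
  · rintro _ ⟨⟨x, hx⟩, rfl⟩
    have hx' := hx
    rw [h.ker_φ] at hx'
    obtain ⟨i, m, hm, rfl⟩ := h.exists_zpow_mul hx'
    obtain ⟨j, k, rfl⟩ := h.exists_of_mem_closure_pair hm
    have : (⟨b ^ i * (c ^ j * d ^ k), hx⟩ : φ.ker) =
        ⟨b, h.φ_b⟩ ^ i * (⟨c, h.φ_c⟩ ^ j * ⟨d, h.φ_d⟩ ^ k) := by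
      ext
      simp
    rw [this]
    simp only [map_mul, map_zpow, eb, ec, ed]
    exact mul_mem (zpow_mem hc _) (mul_mem (zpow_mem hd _)
      (zpow_mem (inv_mem (mul_mem (pow_mem hd 3) (pow_mem hc 3))) _))
  · rw [Subgroup.closure_le]
    rintro x (rfl | rfl)
    exacts [⟨_, eb⟩, ⟨_, ec⟩]

theorem card_ker_commHom (h : MaxClassData a b c d z φ ψ q r) :
    Nat.card h.commHom.ker = 3 := by
  have h1 := h.commHom.ker.card_mul_index
  rw [Subgroup.index_ker, h.range_commHom, h.card_closure_pair, h.card_ker_φ] at h1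
  exact Nat.eq_of_mul_eq_mul_right h.q_pos h1

theorem mem_ker_commHom_iff (h : MaxClassData a b c d z φ ψ q r) (x : φ.ker) :
    x ∈ h.commHom.ker ↔ Commute a x := by
  change (x : G)⁻¹ * (a⁻¹ * x * a) = 1 ↔ a * x = x * a
  rw [inv_mul_eq_one, mul_assoc, eq_inv_mul_iff_mul_eq]

theorem card_ker_inf_centralizer (h : MaxClassData a b c d z φ ψ q r) :
    Nat.card (φ.ker ⊓ Subgroup.centralizer {a} : Subgroup G) = 3 := by
  have : φ.ker ⊓ Subgroup.centralizer {a} = h.commHom.ker.map φ.ker.subtype := by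
    ext x
    rw [Subgroup.mem_inf, Subgroup.mem_centralizer_singleton_iff, Subgroup.mem_map]
    constructor
    · rintro ⟨h1, h2⟩
      exact ⟨⟨x, h1⟩, (h.mem_ker_commHom_iff _).2 h2.symm, rfl⟩
    · rintro ⟨y, hy, rfl⟩
      exact ⟨y.2, ((h.mem_ker_commHom_iff _).1 hy).eq.symm⟩
  rw [this, Subgroup.card_map_of_injective φ.ker.subtype_injective, h.card_ker_commHom]

theorem pow_three_of_commute (h : MaxClassData a b c d z φ ψ q r) {x : G} (hx : φ x = 1)
    (hax : Commute a x) : x ^ 3 = 1 := by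
  have := pow_card_eq_one' (x := (⟨x, hx, Subgroup.mem_centralizer_singleton_iff.2 hax.eq.symm⟩ :
    (φ.ker ⊓ Subgroup.centralizer {a} : Subgroup G)))
  rw [h.card_ker_inf_centralizer] at this
  exact congrArg Subtype.val this

theorem exists_eq_mul_of_φ_ne_one (h : MaxClassData a b c d z φ ψ q r) {g : G} (hg : φ g ≠ 1) :
    ∃ y, φ y = 1 ∧ ψ y = ψ g ∧ (g = a * y ∨ g = a⁻¹ * y) := by
  have ha := h.φ_a
  have ha' := h.ψ_a
  rcases eq_one_or_eq_or_eq (φ g) with h1 | h1 | h1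
  · exact absurd h1 hg
  · exact ⟨a⁻¹ * g, by simp [h1, ha], by simp [ha'], .inl (by group)⟩
  · refine ⟨a * g, ?_, by simp [ha'], .inr (by group)⟩
    rw [map_mul, h1, ha]
    decide

theorem commute_a_iff (h : MaxClassData a b c d z φ ψ q r) {g x : G} (hg : φ g ≠ 1)
    (hx : φ x = 1) : Commute g x ↔ Commute a x := by
  obtain ⟨y, hy, -, rfl | rfl⟩ := h.exists_eq_mul_of_φ_ne_one hg
  · have hyx := h.commute_of_mem_ker hy hx
    refine ⟨fun h1 => ?_, fun h1 => h1.mul_left hyx⟩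
    simpa using h1.mul_left hyx.inv_left
  · have hyx := h.commute_of_mem_ker hy hx
    refine ⟨fun h1 => ?_, fun h1 => h1.inv_left.mul_left hyx⟩
    have := (h1.mul_left hyx.inv_left).inv_left
    simpa using this

/-- The norm map of the action of `a` on the abelian maximal subgroup. -/
def normHom (h : MaxClassData a b c d z φ ψ q r) : φ.ker →* G where
  toFun x := (a⁻¹ * (a⁻¹ * x * a) * a) * (a⁻¹ * x * a) * x
  map_one' := by simp
  map_mul' := by
    rintro ⟨x, hx⟩ ⟨y, hy⟩
    have hx : φ x = 1 := hx
    have hy : φ y = 1 := hy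
    have e1 := (h.commute_of_mem_ker (x := a⁻¹ * (a⁻¹ * y * a) * a) (y := a⁻¹ * x * a)
      (by simp [hy]) (by simp [hx])).eq
    have e2 := (h.commute_of_mem_ker (x := a⁻¹ * (a⁻¹ * y * a) * a * (a⁻¹ * y * a)) (y := x)
      (by simp [hy]) hx).eq
    calc (a⁻¹ * (a⁻¹ * (x * y) * a) * a) * (a⁻¹ * (x * y) * a) * (x * y)
        = (a⁻¹ * (a⁻¹ * x * a) * a) * ((a⁻¹ * (a⁻¹ * y * a) * a) * (a⁻¹ * x * a)) *
          ((a⁻¹ * y * a) * x) * y := by group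
      _ = (a⁻¹ * (a⁻¹ * x * a) * a) * (a⁻¹ * x * a) *
          ((a⁻¹ * (a⁻¹ * y * a) * a) * (a⁻¹ * y * a) * x) * y := by rw [e1]; group
      _ = (a⁻¹ * (a⁻¹ * x * a) * a) * (a⁻¹ * x * a) * x *
          ((a⁻¹ * (a⁻¹ * y * a) * a) * (a⁻¹ * y * a) * y) := by rw [e2]; group

theorem normHom_eq_one_iff (h : MaxClassData a b c d z φ ψ q r) {x : G} (hx : φ x = 1) :
    h.normHom ⟨x, hx⟩ = 1 ↔ ψ x = 1 := by
  have hbc : Commute b c := h.comm_bc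
  have hbd : Commute b d := h.comm_bd
  have hcd : Commute c d := h.comm_cd
  have hcb : ∀ w : G, c * (b * w) = b * (c * w) := fun w => by
    rw [← mul_assoc, ← h.comm_bc, mul_assoc]
  have hdb : ∀ w : G, d * (b * w) = b * (d * w) := fun w => by
    rw [← mul_assoc, ← h.comm_bd, mul_assoc]
  have hdc : ∀ w : G, d * (c * w) = c * (d * w) := fun w => by
    rw [← mul_assoc, ← h.comm_cd, mul_assoc]
  have hmul : ∀ u v : G, a⁻¹ * (u * v) * a = (a⁻¹ * u * a) * (a⁻¹ * v * a) := fun u v => by group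
  have nb : h.normHom ⟨b, h.φ_b⟩ = z⁻¹ := by
    change (a⁻¹ * (a⁻¹ * b * a) * a) * (a⁻¹ * b * a) * b = _
    have hz : z * (d * c ^ 3) = (d * c ^ 3) * z := by
      refine (h.commute_of_mem_closure (pair_le b c d h.z_mem) ?_).eq
      exact mul_mem (d_mem' _ _ _) (pow_mem (c_mem _ _ _) _)
    have h1 : b ^ 3 * (d * c ^ 3) * z = 1 := by
      rw [mul_assoc, ← hz, ← mul_assoc, ← mul_assoc]
      exact h.b_pow
    rw [h.conj_b, hmul, h.conj_b, h.conj_c, ← eq_inv_of_mul_eq_one_left h1]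
    simp only [pow_succ, pow_zero, one_mul, mul_assoc, hcb, hdb, hdc, ← h.comm_bd, ← h.comm_cd]
  have nc : h.normHom ⟨c, h.φ_c⟩ = 1 := by
    change (a⁻¹ * (a⁻¹ * c * a) * a) * (a⁻¹ * c * a) * c = _
    rw [h.conj_c, hmul, h.conj_c, h.conj_d]
    have : Commute (d ^ 3 * c ^ 3)⁻¹ (c * d * c) :=
      h.commute_of_mem_ker (by simp [h.φ_c, h.φ_d]) (by simp [h.φ_c, h.φ_d])
    calc c * d * (d * (d ^ 3 * c ^ 3)⁻¹) * (c * d) * c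
        = c * d * d * ((d ^ 3 * c ^ 3)⁻¹ * (c * d * c)) := by group
      _ = (c * d * d * (c * d * c)) * (d ^ 3 * c ^ 3)⁻¹ := by rw [this.eq]; group
      _ = 1 := by
        rw [mul_inv_eq_one]
        simp only [pow_succ, pow_zero, one_mul, mul_assoc, hdc, ← h.comm_cd]
  have nd : h.normHom ⟨d, h.φ_d⟩ = 1 := by
    have hd : (⟨d, h.φ_d⟩ : φ.ker) = ⟨c, h.φ_c⟩⁻¹ * ⟨a⁻¹ * c * a, by simp [h.φ_c]⟩ := by
      ext
      simp [h.conj_c]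
    have hstep : h.normHom ⟨a⁻¹ * c * a, by simp [h.φ_c]⟩ =
        a⁻¹ * h.normHom ⟨c, h.φ_c⟩ * a := by
      change (a⁻¹ * (a⁻¹ * (a⁻¹ * c * a) * a) * a) * (a⁻¹ * (a⁻¹ * c * a) * a) * (a⁻¹ * c * a) =
        a⁻¹ * ((a⁻¹ * (a⁻¹ * c * a) * a) * (a⁻¹ * c * a) * c) * a
      group
    rw [hd, map_mul, map_inv, hstep, nc]
    group
  have hx' : x ∈ φ.ker := hx
  rw [h.ker_φ] at hx'
  obtain ⟨i, m, hm, rfl⟩ := h.exists_zpow_mul hx'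
  have hψ : ψ m = 1 := h.closure_pair_le_ker hm
  obtain ⟨j, k, rfl⟩ := h.exists_of_mem_closure_pair hm
  have : (⟨b ^ i * (c ^ j * d ^ k), hx⟩ : φ.ker) =
      ⟨b, h.φ_b⟩ ^ i * (⟨c, h.φ_c⟩ ^ j * ⟨d, h.φ_d⟩ ^ k) := by
    ext
    simp
  rw [this, map_mul, map_mul, map_zpow, map_zpow, map_zpow, nb, nc, nd, map_mul, hψ, map_zpow,
    h.ψ_b, mul_one, ofAdd_one_zpow_eq_one_iff, one_zpow, one_zpow, mul_one, mul_one, inv_zpow,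
    inv_eq_one, ← orderOf_dvd_iff_zpow_eq_one, orderOf_eq_prime h.z_pow h.z_ne]
  rfl

theorem pow_three_eq_one_iff (h : MaxClassData a b c d z φ ψ q r) {g : G} (hg : φ g ≠ 1) :
    g ^ 3 = 1 ↔ ψ g = 1 := by
  have ha2 : a ^ 3 = 1 := h.a_pow
  obtain ⟨y, hy, hψ, rfl | rfl⟩ := h.exists_eq_mul_of_φ_ne_one hg
  · rw [← hψ, ← h.normHom_eq_one_iff hy]
    have : (a * y) ^ 3 = a ^ 3 * ((a⁻¹ * (a⁻¹ * y * a) * a) * (a⁻¹ * y * a) * y) := by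
      simp only [pow_succ, pow_zero, one_mul, mul_assoc, mul_inv_cancel_left]
    rw [this, ha2, one_mul]
    rfl
  · rw [← hψ, ← h.normHom_eq_one_iff hy]
    have e : Commute (a * y * a⁻¹) (a⁻¹ * y * a) :=
      h.commute_of_mem_ker (by simp [hy]) (by simp [hy])
    have e3 : a * y * a⁻¹ = a⁻¹ * (a⁻¹ * y * a) * a := by
      have : a = a⁻¹ * a⁻¹ := by
        rw [← mul_inv_rev, eq_inv_iff_mul_eq_one, ← mul_assoc, ← ha2]
        simp only [pow_succ, pow_zero, one_mul]
      calc a * y * a⁻¹ = (a⁻¹ * a⁻¹) * y * (a⁻¹ * a⁻¹)⁻¹ := by rw [← this]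
        _ = _ := by simp only [mul_inv_rev, inv_inv, mul_assoc]
    have : (a⁻¹ * y) ^ 3 = (a ^ 3)⁻¹ * ((a * (a * y * a⁻¹) * a⁻¹) * (a * y * a⁻¹) * y) := by
      simp only [pow_succ, pow_zero, one_mul, mul_assoc, inv_mul_cancel_left, mul_inv_rev]
    have e4 : a * (a * y * a⁻¹) * a⁻¹ = a⁻¹ * y * a := by
      rw [e3]
      group
    rw [this, ha2, inv_one, one_mul, e4, e.eq.symm, e3]
    rfl

theorem c_ne_one (h : MaxClassData a b c d z φ ψ q r) : c ≠ 1 := by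
  intro hc
  have h1 := (h.indep 1 0 (by simp [hc])).1
  have h3 : ((3 : ℕ) : ℤ) ∣ q := by exact_mod_cast h.three_dvd
  have := Int.le_of_dvd one_pos (h3.trans h1)
  norm_num at this

theorem isPGroup_subgroup (h : MaxClassData a b c d z φ ψ q r) (H : Subgroup G) : IsPGroup 3 H :=
  h.isPGroup.to_subgroup H

theorem closure_preimage_eq_top {H : Subgroup G} {u v : G} (hH : Subgroup.closure {u, v} = H)
    (hu : u ∈ H) (hv : v ∈ H) :
    Subgroup.closure {(⟨u, hu⟩ : H), ⟨v, hv⟩} = ⊤ := by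
  apply Subgroup.map_injective H.subtype_injective
  rw [MonoidHom.map_closure, Set.image_pair, ← MonoidHom.range_eq_map, Subgroup.range_subtype]
  exact hH

theorem log_of_mem_center (h : MaxClassData a b c d z φ ψ q r) :
    Nat.log 3 (Nat.card ((⊤ : Subgroup G) ⧸ frattini (⊤ : Subgroup G))) = 2 := by
  have := h.finite
  have : Fact (Nat.Prime 3) := ⟨Nat.prime_three⟩
  refine (h.isPGroup_subgroup ⊤).log_card_quotient_frattini_eq_two (fun hc => ?_)
    (closure_preimage_eq_top (u := a) (v := b) ?_ (Subgroup.mem_top a) (Subgroup.mem_top b))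
  · let := IsCyclic.commGroup (α := (⊤ : Subgroup G))
    have e : (⟨a, trivial⟩ : (⊤ : Subgroup G)) * ⟨b, trivial⟩ = ⟨b, trivial⟩ * ⟨a, trivial⟩ :=
      mul_comm _ _
    have e : a * b = b * a := congrArg Subtype.val e
    have hb := h.conj_b
    rw [mul_assoc, ← e, inv_mul_cancel_left, left_eq_mul] at hb
    exact h.c_ne_one hb
  · have ha : a ∈ Subgroup.closure {a, b} := Subgroup.subset_closure (by simp)
    have hb : b ∈ Subgroup.closure {a, b} := Subgroup.subset_closure (by simp)
    have hc : c ∈ Subgroup.closure {a, b} := by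
      rw [← inv_mul_cancel_left b c, ← h.conj_b]
      exact mul_mem (inv_mem hb) (mul_mem (mul_mem (inv_mem ha) hb) ha)
    have hd : d ∈ Subgroup.closure {a, b} := by
      rw [← inv_mul_cancel_left c d, ← h.conj_c]
      exact mul_mem (inv_mem hc) (mul_mem (mul_mem (inv_mem ha) hc) ha)
    rw [eq_top_iff, ← h.closure_eq, Subgroup.closure_le]
    rintro x (rfl | rfl | rfl | rfl)
    exacts [ha, hb, hc, hd]

theorem log_ker (h : MaxClassData a b c d z φ ψ q r) :
    Nat.log 3 (Nat.card (φ.ker ⧸ frattini φ.ker)) = 2 := by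
  have := h.finite
  have : Fact (Nat.Prime 3) := ⟨Nat.prime_three⟩
  refine (h.isPGroup_subgroup φ.ker).log_card_quotient_frattini_eq_two (fun hc => ?_)
    (closure_preimage_eq_top (u := b) (v := c) ?_ h.φ_b h.φ_c)
  · have hexp : Monoid.exponent φ.ker ∣ 3 * q := by
      apply Monoid.exponent_dvd_of_forall_pow_eq_one
      rintro ⟨x, hx⟩
      ext
      change x ^ (3 * q) = 1
      have hx' := hx
      rw [h.ker_φ] at hx'
      obtain ⟨i, m, hm, rfl⟩ := h.exists_zpow_mul hx'
      obtain ⟨j, k, rfl⟩ := h.exists_of_mem_closure_pair hm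
      have hcd : Commute c d := h.comm_cd
      have hdq : d ^ q = 1 := by
        obtain ⟨t, ht⟩ := h.dvd
        rw [ht, pow_mul, h.d_pow, one_pow]
      have hzq : z ^ q = 1 := by
        obtain ⟨t, ht⟩ := h.three_dvd
        rw [ht, pow_mul, h.z_pow, one_pow]
      have hbq : b ^ (3 * q) = 1 := by
        have hz : φ z = 1 := h.closure_le_ker (pair_le b c d h.z_mem)
        have hb : b ^ 3 = (z * d * c ^ 3)⁻¹ := by
          rw [eq_inv_iff_mul_eq_one]
          simpa only [mul_assoc] using h.b_pow
        have c1 : Commute (z * d) (c ^ 3) := h.commute_of_mem_ker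
          (by simp [hz, h.φ_d]) (by simp [h.φ_c])
        have c2 : Commute z d := h.commute_of_mem_ker hz h.φ_d
        rw [pow_mul, hb, inv_pow, c1.mul_pow, c2.mul_pow, hdq, hzq, ← pow_mul, mul_comm 3,
          pow_mul, h.c_pow]
        simp
      have c1 : Commute (b ^ i) (c ^ j * d ^ k) := h.commute_of_mem_ker
        (by simp [h.φ_b]) (by simp [h.φ_c, h.φ_d])
      have key : ∀ (w : G) (s : ℤ), w ^ (3 * q) = 1 → (w ^ s) ^ (3 * q) = 1 := by
        intro w s hw
        rw [← zpow_natCast, ← zpow_mul, mul_comm, zpow_mul, zpow_natCast, hw, one_zpow]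
      rw [c1.mul_pow, (hcd.zpow_zpow j k).mul_pow, key _ _ hbq,
        key _ _ (by rw [mul_comm, pow_mul, h.c_pow, one_pow]),
        key _ _ (by rw [mul_comm, pow_mul, hdq, one_pow])]
      simp
    rw [IsCyclic.exponent_eq_card, h.card_ker_φ] at hexp
    have hq : 0 < q := Nat.pos_of_mul_pos_right h.q_pos
    have h1 := Nat.le_of_dvd (by positivity) hexp
    have h2 := h.one_lt
    nlinarith
  · rw [h.ker_φ]
    apply le_antisymm
    · rw [Subgroup.closure_le]
      rintro x (rfl | rfl)
      exacts [b_mem _ _ _, c_mem _ _ _]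
    · rw [Subgroup.closure_le]
      rintro x (rfl | rfl | rfl)
      exacts [Subgroup.subset_closure (by simp), Subgroup.subset_closure (by simp), h.d_mem]

theorem centralizer_eq_top (h : MaxClassData a b c d z φ ψ q r) {x : G} (hx : φ x = 1)
    (hax : Commute a x) : Subgroup.centralizer {x} = ⊤ := by
  rw [eq_top_iff]
  intro g _
  rw [Subgroup.mem_centralizer_singleton_iff]
  by_cases hg : φ g = 1
  · exact h.commute_of_mem_ker hg hx
  · exact (h.commute_a_iff hg hx).2 hax

theorem centralizer_eq_ker (h : MaxClassData a b c d z φ ψ q r) {x : G} (hx : φ x = 1)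
    (hax : ¬ Commute a x) : Subgroup.centralizer {x} = φ.ker := by
  ext g
  rw [Subgroup.mem_centralizer_singleton_iff]
  constructor
  · intro hgx
    by_contra hg
    exact hax ((h.commute_a_iff hg hx).1 hgx)
  · intro hg
    exact h.commute_of_mem_ker hg hx

theorem card_centralizer_of_φ_ne_one (h : MaxClassData a b c d z φ ψ q r) {g : G}
    (hg : φ g ≠ 1) : Nat.card (Subgroup.centralizer {g}) = 9 := by
  have hgc : g ∈ Subgroup.centralizer {g} := Subgroup.mem_centralizer_singleton_iff.2 rfl
  have h1 := card_eq_card_ker_mul_three (φ.comp (Subgroup.centralizer {g}).subtype)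
    (x := ⟨g, hgc⟩) hg
  have h2 : (φ.comp (Subgroup.centralizer {g}).subtype).ker =
      (φ.ker ⊓ Subgroup.centralizer {a}).subgroupOf (Subgroup.centralizer {g}) := by
    ext ⟨x, hx⟩
    simp only [MonoidHom.mem_ker, MonoidHom.comp_apply, Subgroup.subtype_apply,
      Subgroup.mem_subgroupOf, Subgroup.mem_inf]
    refine ⟨fun h1 => ⟨h1, ?_⟩, fun h1 => h1.1⟩
    have hx : Commute g x := (Subgroup.mem_centralizer_singleton_iff.1 hx).symm
    exact Subgroup.mem_centralizer_singleton_iff.2 ((h.commute_a_iff hg h1).1 hx).symm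
  have hle : φ.ker ⊓ Subgroup.centralizer {a} ≤ Subgroup.centralizer {g} := by
    rintro x ⟨hx, hx'⟩
    have hx' : Commute a x := (Subgroup.mem_centralizer_singleton_iff.1 hx').symm
    exact Subgroup.mem_centralizer_singleton_iff.2 ((h.commute_a_iff hg hx).2 hx').symm
  rw [h1, h2, Nat.card_congr (Subgroup.subgroupOfEquivOfLe hle).toEquiv,
    h.card_ker_inf_centralizer]

theorem eq_one_or_mul_eq_one {s t : Multiplicative (ZMod 3)} (hs : s ≠ 1) :
    t = 1 ∨ t * s = 1 ∨ t * s⁻¹ = 1 := by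
  revert s t
  decide

theorem log_centralizer_of_pow_eq_one (h : MaxClassData a b c d z φ ψ q r) {g : G}
    (hg : φ g ≠ 1) (hg3 : g ^ 3 = 1) :
    Nat.log 3 (Nat.card (Subgroup.centralizer {g} ⧸ frattini (Subgroup.centralizer {g}))) = 2 := by
  have := h.finite
  have : Fact (Nat.Prime 3) := ⟨Nat.prime_three⟩
  have hcard := h.card_centralizer_of_φ_ne_one hg
  have hnc : ¬ IsCyclic (Subgroup.centralizer {g}) := by
    intro hc
    have hexp : Monoid.exponent (Subgroup.centralizer {g}) ∣ 3 := by
      apply Monoid.exponent_dvd_of_forall_pow_eq_one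
      rintro ⟨x, hx⟩
      ext
      change x ^ 3 = 1
      have hx : Commute g x := (Subgroup.mem_centralizer_singleton_iff.1 hx).symm
      have key : ∀ y : G, Commute g y → φ y = 1 → y ^ 3 = 1 := fun y h1 h2 =>
        h.pow_three_of_commute h2 ((h.commute_a_iff hg h2).1 h1)
      rcases eq_one_or_mul_eq_one (t := φ x) hg with h1 | h1 | h1
      · exact key x hx h1
      · have := key (x * g) (hx.mul_right (Commute.refl g)) (by rw [map_mul, h1])
        rwa [hx.symm.mul_pow, hg3, mul_one] at this
      · have := key (x * g⁻¹) (hx.mul_right (Commute.refl g).inv_right)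
          (by rw [map_mul, map_inv, h1])
        rwa [hx.symm.inv_right.mul_pow, inv_pow, hg3, inv_one, mul_one] at this
    rw [IsCyclic.exponent_eq_card, hcard] at hexp
    norm_num at hexp
  have h1 := (h.isPGroup_subgroup (Subgroup.centralizer {g})).sq_le_card_quotient_frattini hnc
  have h2 := Nat.le_of_dvd (by omega)
    (hcard ▸ (frattini (Subgroup.centralizer {g})).card_quotient_dvd_card)
  rw [le_antisymm h2 h1]
  exact Nat.log_pow (by norm_num) 2

theorem log_centralizer_of_pow_ne_one (h : MaxClassData a b c d z φ ψ q r) {g : G}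
    (hg : φ g ≠ 1) (hg3 : g ^ 3 ≠ 1) :
    Nat.log 3 (Nat.card (Subgroup.centralizer {g} ⧸ frattini (Subgroup.centralizer {g}))) = 1 := by
  have := h.finite
  have : Fact (Nat.Prime 3) := ⟨Nat.prime_three⟩
  have hcard := h.card_centralizer_of_φ_ne_one hg
  have hgc : g ∈ Subgroup.centralizer {g} := Subgroup.mem_centralizer_singleton_iff.2 rfl
  have : Nontrivial (Subgroup.centralizer {g}) :=
    Finite.one_lt_card_iff_nontrivial.1 (by omega)
  apply (h.isPGroup_subgroup (Subgroup.centralizer {g})).log_card_quotient_frattini_eq_one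
    (u := ⟨g, hgc⟩)
  apply Subgroup.eq_top_of_card_eq
  rw [Nat.card_zpowers, hcard]
  have h9 : orderOf (⟨g, hgc⟩ : Subgroup.centralizer {g}) = 3 ^ (1 + 1) := by
    apply orderOf_eq_prime_pow
    · intro h1
      exact hg3 (by simpa using congrArg Subtype.val h1)
    · have := pow_card_eq_one' (x := (⟨g, hgc⟩ : Subgroup.centralizer {g}))
      rwa [hcard] at this
  rw [h9]
  norm_num

theorem log_centralizer (h : MaxClassData a b c d z φ ψ q r) (g : G) :
    Nat.log 3 (Nat.card (Subgroup.centralizer {g} ⧸ frattini (Subgroup.centralizer {g}))) =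
      if φ g ≠ 1 ∧ ψ g ≠ 1 then 1 else 2 := by
  by_cases hg : φ g = 1
  · rw [if_neg (by simp [hg])]
    by_cases hag : Commute a g
    · rw [h.centralizer_eq_top hg hag]
      exact h.log_of_mem_center
    · rw [h.centralizer_eq_ker hg hag]
      exact h.log_ker
  · by_cases hψ : ψ g = 1
    · rw [if_neg (by simp [hψ])]
      exact h.log_centralizer_of_pow_eq_one hg ((h.pow_three_eq_one_iff hg).2 hψ)
    · rw [if_pos ⟨hg, hψ⟩]
      exact h.log_centralizer_of_pow_ne_one hg (mt (h.pow_three_eq_one_iff hg).1 hψ)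

theorem sum_ite_mem [Fintype G] (H : Subgroup G) [DecidablePred (· ∈ H)] (k : ℕ) :
    ∑ g : G, (if g ∈ H then k else 0) = k * Nat.card H := by
  rw [← Finset.sum_filter, Finset.sum_const, smul_eq_mul, mul_comm, Nat.card_eq_fintype_card,
    Fintype.card_subtype]

theorem sInvariant_eq (h : MaxClassData a b c d z φ ψ q r) :
    SInvariant G = 12 + 2 * (q * r) := by
  classical
  have := h.finite
  have := Fintype.ofFinite G
  set m := q * r with hm
  have hclass : ∀ x y : G, IsConj x y →
      (if φ x ≠ 1 ∧ ψ x ≠ 1 then 1 else 2) = if φ y ≠ 1 ∧ ψ y ≠ 1 then 1 else 2 := by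
    intro x y hxy
    rw [isConj_iff_eq.1 (φ.map_isConj hxy), isConj_iff_eq.1 (ψ.map_isConj hxy)]
  have hsum := sum_conjClasses_mul_card (fun g : G => if φ g ≠ 1 ∧ ψ g ≠ 1 then 1 else 2) hclass
    (fun C => Nat.log 3 (Nat.card
      (↥(Subgroup.centralizer {(ConjClasses.exists_rep C).choose}) ⧸
        frattini ↥(Subgroup.centralizer {(ConjClasses.exists_rep C).choose}))))
    (fun x => (h.log_centralizer _).trans (hclass _ _ (ConjClasses.mk_eq_mk_iff_isConj.1
      (ConjClasses.exists_rep (ConjClasses.mk x)).choose_spec)))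
  change _ = _ * SInvariant G at hsum
  have hpt : ∀ g : G, (if φ g ≠ 1 ∧ ψ g ≠ 1 then 1 else 2) *
      Nat.card (Subgroup.centralizer {g}) +
        (if g ∈ Subgroup.closure {c, d} then 9 else 0) + (if g ∈ φ.ker then 9 else 0) =
      (if g ∈ φ.ker ⊓ Subgroup.centralizer {a} then 12 * m else 0) +
        (if g ∈ φ.ker then 6 * m else 0) + 9 + (if g ∈ ψ.ker then 9 else 0) := by
    intro g
    have hZ : g ∈ φ.ker ⊓ Subgroup.centralizer {a} ↔ φ g = 1 ∧ g * a = a * g := by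
      rw [Subgroup.mem_inf, MonoidHom.mem_ker, Subgroup.mem_centralizer_singleton_iff]
    have hM : g ∈ Subgroup.closure {c, d} ↔ φ g = 1 ∧ ψ g = 1 := by
      rw [← h.ker_inf_ker]
      rfl
    simp only [hZ, hM, MonoidHom.mem_ker]
    by_cases hg : φ g = 1
    · by_cases hag : Commute a g
      · rw [h.centralizer_eq_top hg hag, Subgroup.card_top, h.card_eq]
        by_cases hψ : ψ g = 1 <;> simp [hg, hψ, hag.eq] <;> ring
      · have hag' : ¬ g * a = a * g := fun e => hag e.symm
        rw [h.centralizer_eq_ker hg hag, h.card_ker_φ]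
        by_cases hψ : ψ g = 1 <;> simp [hg, hψ, hag'] <;> ring
    · rw [h.card_centralizer_of_φ_ne_one hg]
      by_cases hψ : ψ g = 1 <;> simp [hg, hψ]
  have htot := Finset.sum_congr (rfl : (Finset.univ : Finset G) = Finset.univ)
    (fun g _ => hpt g)
  simp only [Finset.sum_add_distrib, sum_ite_mem, h.card_closure_pair, h.card_ker_φ,
    h.card_ker_ψ, h.card_ker_inf_centralizer, Finset.sum_const, Finset.card_univ, smul_eq_mul,
    ← Nat.card_eq_fintype_card, h.card_eq] at htot
  rw [hsum, h.card_eq, ← hm] at htot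
  have hpos : 0 < 9 * m := Nat.mul_pos (by norm_num) h.q_pos
  apply Nat.eq_of_mul_eq_mul_left hpos
  nlinarith

end MaxClassData

section Gpcomm

variable {G H : Type*} [Group G] [Group H]

theorem map_gpComm (f : G →* H) (x y : G) : f (gpComm x y) = gpComm (f x) (f y) := by
  simp [gpComm]

theorem gpComm_eq_iff {x y w : G} : gpComm x y = w ↔ y⁻¹ * x * y = x * w := by
  rw [gpComm, mul_assoc, mul_assoc, inv_mul_eq_iff_eq_mul, ← mul_assoc]

theorem gpComm_eq_one_iff {x y : G} : gpComm x y = 1 ↔ x * y = y * x := by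
  rw [gpComm_eq_iff, mul_one, mul_assoc, inv_mul_eq_iff_eq_mul]

end Gpcomm

/-- Fibrewise translations of `ZMod 3 × ZMod N`. -/
def fibreTranslation (N : ℕ) :
    Multiplicative (ZMod 3 → ZMod N) →* Equiv.Perm (ZMod 3 × ZMod N) where
  toFun f :=
    { toFun := fun x => (x.1, x.2 + f.toAdd x.1)
      invFun := fun x => (x.1, x.2 - f.toAdd x.1)
      left_inv := fun x => by simp
      right_inv := fun x => by simp }
  map_one' := by
    ext x <;> simp
  map_mul' f g := by
    ext x
    · simp
    · simp only [toAdd_mul, Pi.add_apply, Equiv.coe_fn_mk, Equiv.Perm.coe_mul,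
        Function.comp_apply]
      ring

/-- The cyclic shift of the base of `ZMod 3 × ZMod N`. -/
def baseShift (N : ℕ) : Equiv.Perm (ZMod 3 × ZMod N) :=
  (Equiv.addRight 1).prodCongr (Equiv.refl _)

theorem baseShift_pow_three (N : ℕ) : baseShift N ^ 3 = 1 := by
  have h : ∀ i : ZMod 3, i + 1 + 1 + 1 = i := by decide
  ext ⟨i, t⟩ <;> simp [baseShift, pow_succ, h]

theorem conj_fibreTranslation {N : ℕ} (f : ZMod 3 → ZMod N) :
    (baseShift N)⁻¹ * fibreTranslation N (.ofAdd f) * baseShift N =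
      fibreTranslation N (.ofAdd fun i => f (i + 1)) := by
  rw [mul_assoc, inv_mul_eq_iff_eq_mul]
  ext ⟨i, t⟩ <;> simp [baseShift, fibreTranslation]

theorem gpComm_fibreTranslation {N : ℕ} (f : ZMod 3 → ZMod N) :
    gpComm (fibreTranslation N (.ofAdd f)) (baseShift N) =
      fibreTranslation N (.ofAdd fun i => f (i + 1) - f i) := by
  rw [gpComm_eq_iff, conj_fibreTranslation, ← map_mul, ← ofAdd_add]
  congr 2
  ext i
  simp

theorem fibreTranslation_eq_one {N : ℕ} {f : ZMod 3 → ZMod N}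
    (h : fibreTranslation N (.ofAdd f) = 1) (i : ZMod 3) : f i = 0 := by
  have := congrArg Prod.snd (Equiv.congr_fun h (i, 0))
  simpa [fibreTranslation] using this

namespace MaxClass3

/-- The relators of `T3(n)`, with the exponents of `c` and `d` and the word for `z` made
explicit. -/
def explicitRels (q r : ℕ) (s t : ℤ) : Set (FreeGroup (Fin 4)) :=
  {c⁻¹ * gpComm b a, d⁻¹ * gpComm c a, gpComm d a * d ^ 3 * c ^ 3, gpComm d b, gpComm d c} ∪
    {c ^ q, d ^ r} ∪ {a ^ 3, b ^ 3 * (c ^ s * d ^ t) * d * c ^ 3, gpComm c b}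

theorem T3rels_even (k : ℕ) :
    T3rels (2 * k + 4) = explicitRels (3 ^ (k + 1)) (3 ^ (k + 1)) 0 ((-3) ^ k) := by
  have he : Even (2 * k + 4) := ⟨k + 2, by ring⟩
  have h1 : (2 * k + 4 - 2) / 2 = k + 1 := by omega
  have h2 : (2 * k + 4 - 4) / 2 = k := by omega
  simp only [T3rels, Krels, explicitRels, zWord, if_pos he, h1, h2, zpow_zero, one_mul]

theorem T3rels_odd (m : ℕ) :
    T3rels (2 * m + 3) = explicitRels (3 ^ (m + 1)) (3 ^ m) ((-3) ^ m) 0 := by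
  have he : ¬ Even (2 * m + 3) := by
    rw [Nat.not_even_iff_odd]
    exact ⟨m + 1, by ring⟩
  have h1 : (2 * m + 3 - 1) / 2 = m + 1 := by omega
  have h2 : (2 * m + 3 - 3) / 2 = m := by omega
  simp only [T3rels, Krels, explicitRels, zWord, if_neg he, h1, h2, zpow_zero, mul_one]

/-- The relations of `explicitRels`, satisfied by a tuple of elements. -/
structure IsSolution {H : Type*} [Group H] (q r : ℕ) (s t : ℤ) (A B C D : H) : Prop where
  rel_c : gpComm B A = C
  rel_d : gpComm C A = D
  rel_da : gpComm D A * D ^ 3 * C ^ 3 = 1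
  rel_db : gpComm D B = 1
  rel_dc : gpComm D C = 1
  c_pow : C ^ q = 1
  d_pow : D ^ r = 1
  a_pow : A ^ 3 = 1
  b_pow : B ^ 3 * (C ^ s * D ^ t) * D * C ^ 3 = 1
  rel_cb : gpComm C B = 1

theorem IsSolution.lift_eq_one {H : Type*} [Group H] {q r : ℕ} {s t : ℤ} {A B C D : H}
    (h : IsSolution q r s t A B C D) :
    ∀ w ∈ explicitRels q r s t, FreeGroup.lift ![A, B, C, D] w = 1 := by
  intro w hw
  simp only [explicitRels, Set.mem_union, Set.mem_insert_iff, Set.mem_singleton_iff] at hw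
  rcases hw with ((rfl | rfl | rfl | rfl | rfl) | (rfl | rfl)) | (rfl | rfl | rfl) <;>
    simp only [map_mul, map_inv, map_pow, map_zpow, map_gpComm, FreeGroup.lift_apply_of,
      Matrix.cons_val]
  · rw [h.rel_c, inv_mul_cancel]
  · rw [h.rel_d, inv_mul_cancel]
  · exact h.rel_da
  · exact h.rel_db
  · exact h.rel_dc
  · exact h.c_pow
  · exact h.d_pow
  · exact h.a_pow
  · exact h.b_pow
  · exact h.rel_cb

theorem isSolution_of (q r : ℕ) (s t : ℤ) :
    IsSolution q r s t (PresentedGroup.mk (explicitRels q r s t) a)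
      (PresentedGroup.mk (explicitRels q r s t) b) (PresentedGroup.mk (explicitRels q r s t) c)
      (PresentedGroup.mk (explicitRels q r s t) d) := by
  have rel : ∀ w ∈ explicitRels q r s t, PresentedGroup.mk (explicitRels q r s t) w = 1 :=
    fun w => PresentedGroup.one_of_mem
  generalize hR : PresentedGroup.mk (explicitRels q r s t) = π at rel
  constructor
  · have h := rel (c⁻¹ * gpComm b a) (by simp [explicitRels])
    rw [map_mul, map_inv, map_gpComm] at h
    exact (inv_mul_eq_one.1 h).symm
  · have h := rel (d⁻¹ * gpComm c a) (by simp [explicitRels])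
    rw [map_mul, map_inv, map_gpComm] at h
    exact (inv_mul_eq_one.1 h).symm
  · have h := rel (gpComm d a * d ^ 3 * c ^ 3) (by simp [explicitRels])
    rwa [map_mul, map_mul, map_pow, map_pow, map_gpComm] at h
  · have h := rel (gpComm d b) (by simp [explicitRels])
    rwa [map_gpComm] at h
  · have h := rel (gpComm d c) (by simp [explicitRels])
    rwa [map_gpComm] at h
  · have h := rel (c ^ q) (by simp [explicitRels])
    rwa [map_pow] at h
  · have h := rel (d ^ r) (by simp [explicitRels])
    rwa [map_pow] at h
  · have h := rel (a ^ 3) (by simp [explicitRels])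
    rwa [map_pow] at h
  · have h := rel (b ^ 3 * (c ^ s * d ^ t) * d * c ^ 3) (by simp [explicitRels])
    rwa [map_mul, map_mul, map_mul, map_mul, map_pow, map_pow, map_zpow, map_zpow] at h
  · have h := rel (gpComm c b) (by simp [explicitRels])
    rwa [map_gpComm] at h

theorem closure_generators (R : Set (FreeGroup (Fin 4))) :
    Subgroup.closure {PresentedGroup.mk R a, PresentedGroup.mk R b, PresentedGroup.mk R c,
      PresentedGroup.mk R d} = ⊤ := by
  rw [eq_top_iff, ← PresentedGroup.closure_range_of R, Subgroup.closure_le]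
  rintro _ ⟨i, rfl⟩
  apply Subgroup.subset_closure
  match i with
  | 0 => exact Or.inl rfl
  | 1 => exact Or.inr (Or.inl rfl)
  | 2 => exact Or.inr (Or.inr (Or.inl rfl))
  | 3 => exact Or.inr (Or.inr (Or.inr rfl))

theorem isSolution_fst (q r : ℕ) (s t : ℤ) :
    IsSolution q r s t (Multiplicative.ofAdd (1 : ZMod 3)) 1 1 1 := by
  constructor <;> first | decide | simp

theorem isSolution_snd (q r : ℕ) (s t : ℤ) :
    IsSolution q r s t 1 (Multiplicative.ofAdd (1 : ZMod 3)) 1 1 := by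
  have h : Multiplicative.ofAdd (1 : ZMod 3) ^ 3 = 1 := by decide
  constructor <;> first | decide | simp [h]

section Model

variable {q r N : ℕ} {s t : ℤ} {f f' f'' : ZMod 3 → ZMod N}

theorem isSolution_fibreTranslation
    (hf : ∀ i, f' i = f (i + 1) - f i) (hf' : ∀ i, f'' i = f' (i + 1) - f' i)
    (hfq : ∀ i, (q : ZMod N) * f' i = 0) (hfr : ∀ i, (r : ZMod N) * f'' i = 0)
    (hfz : ∀ i, 3 * f i + (s * f' i + t * f'' i) + f'' i + 3 * f' i = 0) :
    IsSolution q r s t (baseShift N) (fibreTranslation N (.ofAdd f))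
      (fibreTranslation N (.ofAdd f')) (fibreTranslation N (.ofAdd f'')) := by
  have hT : ∀ g : ZMod 3 → ZMod N, (∀ i, g i = 0) → fibreTranslation N (.ofAdd g) = 1 := by
    intro g hg
    rw [show g = 0 from funext hg, ofAdd_zero, map_one]
  have hcomm : ∀ g g' : Multiplicative (ZMod 3 → ZMod N),
      gpComm (fibreTranslation N g) (fibreTranslation N g') = 1 := by
    intro g g'
    rw [gpComm_eq_one_iff, ← map_mul, ← map_mul, mul_comm]
  obtain rfl : f' = fun i => f (i + 1) - f i := funext hf
  obtain rfl : f'' = _ := funext hf'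
  refine ⟨gpComm_fibreTranslation f, gpComm_fibreTranslation _, ?_, hcomm _ _, hcomm _ _, ?_, ?_,
    baseShift_pow_three N, ?_, hcomm _ _⟩
  · rw [gpComm_fibreTranslation]
    simp only [← map_pow (fibreTranslation N), ← map_mul (fibreTranslation N), ← ofAdd_nsmul,
      ← ofAdd_add]
    apply hT
    have h : ∀ i : ZMod 3, i + 1 + 1 + 1 = i := by decide
    intro i
    simp only [Pi.add_apply, Pi.smul_apply, h]
    simp only [nsmul_eq_mul]
    push_cast
    ring
  · rw [← map_pow, ← ofAdd_nsmul]
    exact hT _ fun i => by simpa using hfq i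
  · rw [← map_pow, ← ofAdd_nsmul]
    exact hT _ fun i => by simpa using hfr i
  · simp only [← map_pow (fibreTranslation N), ← map_zpow (fibreTranslation N),
      ← map_mul (fibreTranslation N), ← ofAdd_nsmul, ← ofAdd_zsmul, ← ofAdd_add]
    exact hT _ fun i => by simpa using hfz i

end Model

theorem exists_maxClassData {q r N : ℕ} {s t : ℤ} {f f' f'' : ZMod 3 → ZMod N}
    (hqs : (q : ℤ) ∣ s * 3) (hrt : (r : ℤ) ∣ t * 3) (hst : ¬ ((q : ℤ) ∣ s ∧ (r : ℤ) ∣ t))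
    (hcop : IsCoprime (t + 1) (r : ℤ)) (dvd : r ∣ q) (one_lt : 1 < r) (three_dvd : 3 ∣ q)
    (exists_pow : ∃ k : ℕ, q * r = 3 ^ k)
    (hf : ∀ i, f' i = f (i + 1) - f i) (hf' : ∀ i, f'' i = f' (i + 1) - f' i)
    (hfq : ∀ i, (q : ZMod N) * f' i = 0) (hfr : ∀ i, (r : ZMod N) * f'' i = 0)
    (hfz : ∀ i, 3 * f i + (s * f' i + t * f'' i) + f'' i + 3 * f' i = 0)
    (hind : ∀ u v : ℤ, (∀ i, u * f' i + v * f'' i = 0) → (q : ℤ) ∣ u ∧ (r : ℤ) ∣ v) :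
    ∃ (a b c d z : PresentedGroup (explicitRels q r s t))
      (φ ψ : PresentedGroup (explicitRels q r s t) →* Multiplicative (ZMod 3)),
      MaxClassData a b c d z φ ψ q r := by
  have hφ := (isSolution_fst q r s t).lift_eq_one
  have hψ := (isSolution_snd q r s t).lift_eq_one
  have hρ := (isSolution_fibreTranslation hf hf' hfq hfr hfz).lift_eq_one
  have hc : PresentedGroup.toGroup hρ (PresentedGroup.mk _ c) = fibreTranslation N (.ofAdd f') :=
    PresentedGroup.toGroup.of hρ
  have hd : PresentedGroup.toGroup hρ (PresentedGroup.mk _ d) = fibreTranslation N (.ofAdd f'') :=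
    PresentedGroup.toGroup.of hρ
  have hcl := closure_generators (explicitRels q r s t)
  have sol := isSolution_of q r s t
  have φa : PresentedGroup.toGroup hφ (PresentedGroup.mk _ a) = _ := PresentedGroup.toGroup.of hφ
  have φb : PresentedGroup.toGroup hφ (PresentedGroup.mk _ b) = _ := PresentedGroup.toGroup.of hφ
  have φc : PresentedGroup.toGroup hφ (PresentedGroup.mk _ c) = _ := PresentedGroup.toGroup.of hφ
  have φd : PresentedGroup.toGroup hφ (PresentedGroup.mk _ d) = _ := PresentedGroup.toGroup.of hφ
  have ψa : PresentedGroup.toGroup hψ (PresentedGroup.mk _ a) = _ := PresentedGroup.toGroup.of hψ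
  have ψb : PresentedGroup.toGroup hψ (PresentedGroup.mk _ b) = _ := PresentedGroup.toGroup.of hψ
  have ψc : PresentedGroup.toGroup hψ (PresentedGroup.mk _ c) = _ := PresentedGroup.toGroup.of hψ
  have ψd : PresentedGroup.toGroup hψ (PresentedGroup.mk _ d) = _ := PresentedGroup.toGroup.of hψ
  generalize PresentedGroup.mk (explicitRels q r s t) a = A at *
  generalize PresentedGroup.mk (explicitRels q r s t) b = B at *
  generalize PresentedGroup.mk (explicitRels q r s t) c = C at *
  generalize PresentedGroup.mk (explicitRels q r s t) d = D at *
  have hCD : Commute C D := (gpComm_eq_one_iff.1 sol.rel_dc).symm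
  have indep : ∀ i j : ℤ, C ^ i * D ^ j = 1 → (q : ℤ) ∣ i ∧ (r : ℤ) ∣ j := by
    intro i j hij
    apply hind
    have h1 := congrArg (PresentedGroup.toGroup hρ) hij
    rw [map_mul, map_zpow, map_zpow, map_one, hc, hd] at h1
    simp only [← map_zpow (fibreTranslation N), ← map_mul (fibreTranslation N), ← ofAdd_zsmul,
      ← ofAdd_add] at h1
    intro l
    simpa using fibreTranslation_eq_one h1 l
  have zpow_dvd : ∀ (w : PresentedGroup (explicitRels q r s t)) (e : ℕ) (u : ℤ),
      w ^ e = 1 → (e : ℤ) ∣ u → w ^ u = 1 := by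
    rintro w e _ hw ⟨v, rfl⟩
    rw [zpow_mul, zpow_natCast, hw, one_zpow]
  refine ⟨A, B, C, D, C ^ s * D ^ t, PresentedGroup.toGroup hφ, PresentedGroup.toGroup hψ,
    { closure_eq := hcl
      conj_b := gpComm_eq_iff.1 sol.rel_c
      conj_c := gpComm_eq_iff.1 sol.rel_d
      conj_d := gpComm_eq_iff.1 (eq_inv_of_mul_eq_one_left (by rw [← mul_assoc, sol.rel_da]))
      comm_bc := (gpComm_eq_one_iff.1 sol.rel_cb).symm
      comm_bd := (gpComm_eq_one_iff.1 sol.rel_db).symm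
      comm_cd := hCD
      a_pow := sol.a_pow
      b_pow := sol.b_pow
      z_mem := mul_mem (zpow_mem (Subgroup.subset_closure (by simp)) _)
        (zpow_mem (Subgroup.subset_closure (by simp)) _)
      z_pow := ?_
      z_ne := fun h => hst (indep s t h)
      d_mem := ?_
      c_pow := sol.c_pow
      d_pow := sol.d_pow
      indep := indep
      φ_a := φa
      φ_b := φb
      φ_c := φc
      φ_d := φd
      ψ_a := ψa
      ψ_b := ψb
      ψ_c := ψc
      ψ_d := ψd
      dvd := dvd
      one_lt := one_lt
      three_dvd := three_dvd
      exists_pow := exists_pow }⟩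
  · rw [(hCD.zpow_zpow s t).mul_pow, ← zpow_natCast, ← zpow_natCast, ← zpow_mul, ← zpow_mul]
    rw [zpow_dvd _ _ _ sol.c_pow (by exact_mod_cast hqs),
      zpow_dvd _ _ _ sol.d_pow (by exact_mod_cast hrt), one_mul]
  · have hb : B ∈ Subgroup.closure {B, C} := Subgroup.subset_closure (by simp)
    have hc : C ∈ Subgroup.closure {B, C} := Subgroup.subset_closure (by simp)
    have hdt : D ^ (t + 1) ∈ Subgroup.closure {B, C} := by
      have : D ^ (t + 1) = (B ^ 3 * C ^ s)⁻¹ * (C ^ 3)⁻¹ := by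
        rw [zpow_add_one, eq_mul_inv_iff_mul_eq, eq_comm, inv_eq_iff_mul_eq_one, ← sol.b_pow]
        simp only [mul_assoc]
      rw [this]
      exact mul_mem (inv_mem (mul_mem (pow_mem hb _) (zpow_mem hc _))) (inv_mem (pow_mem hc _))
    obtain ⟨u, v, huv⟩ := hcop
    have : D = (D ^ (t + 1)) ^ u := by
      rw [← zpow_mul, mul_comm, eq_sub_of_add_eq huv, zpow_sub, zpow_one,
        zpow_dvd D r _ sol.d_pow (dvd_mul_left _ _), inv_one, mul_one]
    rw [this]
    exact zpow_mem hdt u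

theorem forall_zmod_three {P : ZMod 3 → Prop} (h0 : P 0) (h1 : P 1) (h2 : P 2) : ∀ i, P i := by
  intro i
  fin_cases i
  exacts [h0, h1, h2]

theorem neg_three_pow_eq_zero {k l : ℕ} (h : k ≤ l) : (-3 : ZMod (3 ^ k)) ^ l = 0 := by
  have hN : (3 : ZMod (3 ^ k)) ^ k = 0 := by
    exact_mod_cast ZMod.natCast_self (3 ^ k)
  exact pow_eq_zero_of_le h (by rw [neg_pow, hN, mul_zero])

theorem three_pow_eq_zero {k l : ℕ} (h : k ≤ l) : (3 : ZMod (3 ^ k)) ^ l = 0 := by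
  have hN : (3 : ZMod (3 ^ k)) ^ k = 0 := by
    exact_mod_cast ZMod.natCast_self (3 ^ k)
  exact pow_eq_zero_of_le h hN

theorem pow_dvd_of_intCast_mul_three_eq_zero {k : ℕ} {u : ℤ}
    (h : (u : ZMod (3 ^ (k + 1))) * 3 = 0) : (3 : ℤ) ^ k ∣ u := by
  have h1 : ((3 ^ (k + 1) : ℕ) : ℤ) ∣ u * 3 := by
    rw [← ZMod.intCast_zmod_eq_zero_iff_dvd]
    push_cast
    exact h
  push_cast at h1
  rw [pow_succ] at h1
  exact (mul_dvd_mul_iff_right (by norm_num)).1 h1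

theorem not_pow_dvd_neg_three_pow (k : ℕ) : ¬ ((3 ^ (k + 1) : ℕ) : ℤ) ∣ (-3) ^ k := by
  intro h
  rw [← Int.natAbs_dvd_natAbs, Int.natAbs_natCast, Int.natAbs_pow] at h
  have := (Nat.pow_dvd_pow_iff_le_right (by norm_num)).1 h
  omega

theorem pow_dvd_neg_three_pow_mul (k : ℕ) : ((3 ^ (k + 1) : ℕ) : ℤ) ∣ (-3) ^ k * 3 := by
  refine ⟨(-1) ^ k, ?_⟩
  push_cast
  rw [neg_pow]
  ring

theorem sInvariant_even (k : ℕ) : SInvariant (T3 (2 * k + 4)) = 12 + 2 * 3 ^ (2 * k + 2) := by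
  change SInvariant (PresentedGroup (T3rels (2 * k + 4))) = _
  rw [T3rels_even]
  have h0 := three_pow_eq_zero (le_refl (k + 2))
  have h1 := neg_three_pow_eq_zero (le_refl (k + 2))
  obtain ⟨_, _, _, _, _, _, _, h⟩ := exists_maxClassData (q := 3 ^ (k + 1)) (r := 3 ^ (k + 1))
    (N := 3 ^ (k + 2)) (s := 0) (t := (-3) ^ k)
    (f := ![-1 - (-3) ^ k, -1 - (-3) ^ k, 2 - (-3) ^ k])
    (f' := ![0, 3, -3]) (f'' := ![3, -6, 3]) (by simp) (pow_dvd_neg_three_pow_mul k)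
    (fun h => not_pow_dvd_neg_three_pow k h.2)
    (by
      push_cast
      apply IsCoprime.pow_right
      rcases k with _ | k
      · exact ⟨-1, 1, by norm_num⟩
      · exact ⟨1, (-3) ^ k, by ring⟩)
    dvd_rfl (Nat.one_lt_pow (by omega) (by norm_num)) (dvd_pow_self 3 (by omega))
    ⟨(k + 1) + (k + 1), (pow_add _ _ _).symm⟩
    (forall_zmod_three
      (by change (0 : ZMod (3 ^ (k + 2))) = (-1 - (-3) ^ k) - (-1 - (-3) ^ k); ring)
      (by change (3 : ZMod (3 ^ (k + 2))) = (2 - (-3) ^ k) - (-1 - (-3) ^ k); ring)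
      (by change (-3 : ZMod (3 ^ (k + 2))) = (-1 - (-3) ^ k) - (2 - (-3) ^ k); ring))
    (forall_zmod_three (by change (3 : ZMod (3 ^ (k + 2))) = 3 - 0; ring)
      (by change (-6 : ZMod (3 ^ (k + 2))) = -3 - 3; ring)
      (by change (3 : ZMod (3 ^ (k + 2))) = 0 - -3; ring))
    (by
      push_cast
      refine forall_zmod_three ?_ ?_ ?_ <;> simp only [Matrix.cons_val]
      · ring
      · linear_combination h0
      · linear_combination -h0)
    (by
      push_cast
      refine forall_zmod_three ?_ ?_ ?_ <;> simp only [Matrix.cons_val]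
      · linear_combination h0
      · linear_combination -2 * h0
      · linear_combination h0)
    (by
      push_cast
      refine forall_zmod_three ?_ ?_ ?_ <;> simp only [Matrix.cons_val]
      · ring
      · linear_combination -h1
      · ring)
    (by
      intro u v huv
      have e0 : (u : ZMod (3 ^ (k + 2))) * 0 + v * 3 = 0 := huv 0
      have e1 : (u : ZMod (3 ^ (k + 2))) * 3 + v * (-6) = 0 := huv 1
      push_cast
      constructor
      · exact pow_dvd_of_intCast_mul_three_eq_zero (by linear_combination e1 + 2 * e0)
      · exact pow_dvd_of_intCast_mul_three_eq_zero (by linear_combination e0))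
  rw [h.sInvariant_eq]
  ring

theorem sInvariant_odd (m : ℕ) : SInvariant (T3 (2 * m + 5)) = 12 + 2 * 3 ^ (2 * m + 3) := by
  change SInvariant (PresentedGroup (T3rels (2 * (m + 1) + 3))) = _
  rw [T3rels_odd]
  have h0 := three_pow_eq_zero (le_refl (m + 2))
  have h1 := neg_three_pow_eq_zero (le_refl (m + 2))
  obtain ⟨_, _, _, _, _, _, _, h⟩ := exists_maxClassData (q := 3 ^ (m + 2)) (r := 3 ^ (m + 1))
    (N := 3 ^ (m + 2)) (s := (-3) ^ (m + 1)) (t := 0)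
    (f := ![-1 + (-3) ^ m, (-3) ^ m, 1 + (-3) ^ m])
    (f' := ![1, 1, -2]) (f'' := ![0, -3, 3]) (pow_dvd_neg_three_pow_mul (m + 1)) (by simp)
    (fun h => not_pow_dvd_neg_three_pow (m + 1) h.1)
    (by simpa using isCoprime_one_left)
    (pow_dvd_pow 3 (by omega)) (Nat.one_lt_pow (by omega) (by norm_num))
    (dvd_pow_self 3 (by omega)) ⟨(m + 2) + (m + 1), (pow_add _ _ _).symm⟩
    (forall_zmod_three
      (by change (1 : ZMod (3 ^ (m + 2))) = (-3) ^ m - (-1 + (-3) ^ m); ring)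
      (by change (1 : ZMod (3 ^ (m + 2))) = (1 + (-3) ^ m) - (-3) ^ m; ring)
      (by change (-2 : ZMod (3 ^ (m + 2))) = (-1 + (-3) ^ m) - (1 + (-3) ^ m); ring))
    (forall_zmod_three (by change (0 : ZMod (3 ^ (m + 2))) = 1 - 1; ring)
      (by change (-3 : ZMod (3 ^ (m + 2))) = -2 - 1; ring)
      (by change (3 : ZMod (3 ^ (m + 2))) = 1 - -2; ring))
    (by
      push_cast
      simp [h0])
    (by
      push_cast
      refine forall_zmod_three ?_ ?_ ?_ <;> simp only [Matrix.cons_val]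
      · ring
      · linear_combination -h0
      · linear_combination h0)
    (by
      push_cast
      refine forall_zmod_three ?_ ?_ ?_ <;> simp only [Matrix.cons_val]
      · ring
      · ring
      · linear_combination h1)
    (by
      intro u v huv
      have e0 : (u : ZMod (3 ^ (m + 2))) * 1 + v * 0 = 0 := huv 0
      have e1 : (u : ZMod (3 ^ (m + 2))) * 1 + v * (-3) = 0 := huv 1
      constructor
      · rw [← ZMod.intCast_zmod_eq_zero_iff_dvd]
        linear_combination e0
      · push_cast
        exact pow_dvd_of_intCast_mul_three_eq_zero (by linear_combination e0 - e1))
  rw [h.sInvariant_eq]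
  ring

end MaxClass3

open MaxClass3 in
/-- For `n ≥ 4`, the group `T3(n)` satisfies `S(T3(n)) = 12 + 2·3^{n-2}`. -/
theorem SInvariant_T3 (n : ℕ) (hn : 4 ≤ n) :
    SInvariant (T3 n) = 12 + 2 * 3 ^ (n - 2) := by
  rcases Nat.even_or_odd' n with ⟨k, rfl | rfl⟩
  · obtain ⟨k, rfl⟩ := Nat.exists_eq_add_of_le' (show 2 ≤ k by omega)
    exact sInvariant_even k
  · obtain ⟨k, rfl⟩ := Nat.exists_eq_add_of_le' (show 2 ≤ k by omega)
    exact sInvariant_odd k
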